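/- Let K ⊂ ℝ^N be a convex body whose heart ♥(K) has affine dimension k with 1 ≤ k ≤ N − 1 (in particular ♥(K) has empty interior). Then there exists a direction θ ∈ S^{N-1} such that R_K(θ) = ⟨M_K, θ⟩ and K is θ-symmetric, i.e. T_{λ,θ}(K) = K for some λ ∈ ℝ. -/

import Mathlib

open MeasureTheory Set Metric
open scoped RealInnerProductSpace ENNReal NNReal

noncomputable section

/-- Reflection of `x` across the hyperplane `{z : ⟪z, ω⟫ = l}` (for a unit vector `ω`). -/
def reflectH {N : ℕ} (l : ℝ) (ω x : EuclideanSpace ℝ (Fin N)) : EuclideanSpace ℝ (Fin N) :=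
  x + (2 * (l - ⟪x, ω⟫)) • ω

/-- The maximal folding function of a set `K`:
`R_K(ω) = inf {l : the reflection of K ∩ {⟪·,ω⟫ ≥ l} across {⟪·,ω⟫ = l} lies in K}`. -/
def foldingFn {N : ℕ} (K : Set (EuclideanSpace ℝ (Fin N))) (ω : EuclideanSpace ℝ (Fin N)) : ℝ :=
  sInf {l : ℝ | reflectH l ω '' {x ∈ K | l ≤ ⟪x, ω⟫} ⊆ K}

/-- The heart of a set `K`. -/
def heart {N : ℕ} (K : Set (EuclideanSpace ℝ (Fin N))) : Set (EuclideanSpace ℝ (Fin N)) :=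
  {x ∈ K | ∀ ω : EuclideanSpace ℝ (Fin N), ‖ω‖ = 1 → ⟪x, ω⟫ ≤ foldingFn K ω}

/-- The center of mass of `K` (w.r.t. Lebesgue measure). -/
def centerOfMass {N : ℕ} (K : Set (EuclideanSpace ℝ (Fin N))) : EuclideanSpace ℝ (Fin N) :=
  (volume K).toReal⁻¹ • ∫ y in K, y

section Reflection

variable {N : ℕ}

theorem inner_reflectH {ω : EuclideanSpace ℝ (Fin N)} (hω : ‖ω‖ = 1) (l : ℝ)
    (x : EuclideanSpace ℝ (Fin N)) : ⟪reflectH l ω x, ω⟫ = 2 * l - ⟪x, ω⟫ := by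
  simp only [reflectH, inner_add_left, real_inner_smul_left, real_inner_self_eq_norm_sq, hω]
  ring

theorem reflectH_reflectH {ω : EuclideanSpace ℝ (Fin N)} (hω : ‖ω‖ = 1) (l : ℝ)
    (x : EuclideanSpace ℝ (Fin N)) : reflectH l ω (reflectH l ω x) = x := by
  have h := inner_reflectH hω l x
  rw [reflectH, h, reflectH]
  module

theorem reflectH_of_inner_eq {ω x : EuclideanSpace ℝ (Fin N)} {l : ℝ} (h : ⟪x, ω⟫ = l) :
    reflectH l ω x = x := by
  simp [reflectH, h]

theorem continuous_reflectH (l : ℝ) (ω : EuclideanSpace ℝ (Fin N)) :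
    Continuous (reflectH l ω) := by
  unfold reflectH
  fun_prop

theorem measurePreserving_reflectH {ω : EuclideanSpace ℝ (Fin N)} (hω : ‖ω‖ = 1) (l : ℝ) :
    MeasurePreserving (reflectH l ω) volume volume := by
  have heq : reflectH l ω = (fun x => x + (2 * l) • ω) ∘ Submodule.reflection (ℝ ∙ ω)ᗮ := by
    funext x
    rw [Function.comp_apply, Submodule.reflection_orthogonal_apply,
      Submodule.reflection_singleton_apply, reflectH, hω, real_inner_comm x ω]
    simp only [RCLike.ofReal_real_eq_id, id_eq, one_pow, div_one]
    module
  rw [heq]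
  exact (measurePreserving_add_right _ _).comp
    (Submodule.reflection (ℝ ∙ ω)ᗮ).measurePreserving

theorem measurableEmbedding_reflectH {ω : EuclideanSpace ℝ (Fin N)} (hω : ‖ω‖ = 1) (l : ℝ) :
    MeasurableEmbedding (reflectH l ω) :=
  (continuous_reflectH l ω).measurableEmbedding
    (Function.LeftInverse.injective (reflectH_reflectH hω l))

end Reflection

section Folding

variable {N : ℕ} {K : Set (EuclideanSpace ℝ (Fin N))}

/-- The pairs `(l, ω)` such that the cap of `K` beyond `{⟪·, ω⟫ = l}` folds into `K`. -/
def foldable (K : Set (EuclideanSpace ℝ (Fin N))) : Set (ℝ × EuclideanSpace ℝ (Fin N)) :=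
  {p | reflectH p.1 p.2 '' {x ∈ K | p.1 ≤ ⟪x, p.2⟫} ⊆ K}

theorem mem_foldable {l : ℝ} {ω : EuclideanSpace ℝ (Fin N)} :
    (l, ω) ∈ foldable K ↔ ∀ x ∈ K, l ≤ ⟪x, ω⟫ → reflectH l ω x ∈ K := by
  simp only [foldable, mem_ofPred_eq, image_subset_iff]
  exact ⟨fun h x hx hl => h ⟨hx, hl⟩, fun h x hx => h x hx.1 hx.2⟩

theorem isClosed_foldable (hK : IsClosed K) : IsClosed (foldable K) := by
  have h : foldable K = ⋂ x ∈ K, ({p : ℝ × EuclideanSpace ℝ (Fin N) | ⟪x, p.2⟫ ≤ p.1} ∪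
      (fun p : ℝ × EuclideanSpace ℝ (Fin N) => reflectH p.1 p.2 x) ⁻¹' K) := by
    ext ⟨l, ω⟩
    simp only [mem_foldable, mem_iInter, mem_union, mem_ofPred_eq, mem_preimage]
    refine forall₂_congr fun x hx => ⟨fun h => ?_, fun h hl => ?_⟩
    · exact (le_total ⟪x, ω⟫ l).imp id h
    · rcases h with h | h
      · rwa [reflectH_of_inner_eq (le_antisymm h hl)]
      · exact h
  rw [h]
  refine isClosed_biInter fun x _ => IsClosed.union ?_ (hK.preimage ?_)
  · exact isClosed_le (by fun_prop) (by fun_prop)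
  · unfold reflectH
    fun_prop

theorem exists_mem_foldable (hK : IsCompact K) (ω : EuclideanSpace ℝ (Fin N)) :
    ∃ l, (l, ω) ∈ foldable K := by
  obtain ⟨b, hb⟩ := hK.bddAbove_image (f := fun x => ⟪x, ω⟫) (by fun_prop)
  refine ⟨b + 1, mem_foldable.2 fun x hx hl => ?_⟩
  linarith [hb (mem_image_of_mem _ hx)]

theorem integrable_indicator_inner_sub (hK : IsCompact K) (ω : EuclideanSpace ℝ (Fin N)) (l : ℝ) :
    Integrable (K.indicator fun x => ⟪x, ω⟫ - l) :=
  (ContinuousOn.integrableOn_compact hK (by fun_prop)).integrable_indicator hK.measurableSet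

theorem integral_indicator_inner_sub (hK : IsCompact K) (hKint : (interior K).Nonempty)
    (ω : EuclideanSpace ℝ (Fin N)) (l : ℝ) :
    ∫ x, K.indicator (fun x => ⟪x, ω⟫ - l) x = volume.real K * (⟪centerOfMass K, ω⟫ - l) := by
  have h0 : volume.real K ≠ 0 :=
    (ENNReal.toReal_pos (Measure.measure_pos_of_nonempty_interior _ hKint).ne' hK.measure_lt_top.ne).ne'
  have hi : IntegrableOn (fun x : EuclideanSpace ℝ (Fin N) => x) K :=
    ContinuousOn.integrableOn_compact hK continuousOn_id
  have h1 : ∫ x in K, ⟪x, ω⟫ = ⟪∫ x in K, x, ω⟫ := by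
    simp_rw [fun x => real_inner_comm ω x]
    exact integral_inner hi ω
  have hc : IntegrableOn (fun _ : EuclideanSpace ℝ (Fin N) => l) K :=
    ContinuousOn.integrableOn_compact hK continuousOn_const
  have hin : IntegrableOn (fun x : EuclideanSpace ℝ (Fin N) => ⟪x, ω⟫) K :=
    ContinuousOn.integrableOn_compact hK (by fun_prop)
  rw [integral_indicator hK.measurableSet, integral_sub hin hc, h1, setIntegral_const,
    centerOfMass, real_inner_smul_left, smul_eq_mul]
  change _ = volume.real K * ((volume.real K)⁻¹ * _ - l)
  field_simp

theorem indicator_add_indicator_reflectH_nonpos {l : ℝ} {ω : EuclideanSpace ℝ (Fin N)}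
    (hω : ‖ω‖ = 1) (hl : (l, ω) ∈ foldable K) (x : EuclideanSpace ℝ (Fin N)) :
    K.indicator (fun x => ⟪x, ω⟫ - l) x +
      K.indicator (fun x => ⟪x, ω⟫ - l) (reflectH l ω x) ≤ 0 := by
  have hT := inner_reflectH hω l x
  have h1 := mem_foldable.1 hl x
  have h2 := mem_foldable.1 hl (reflectH l ω x)
  rw [reflectH_reflectH hω, hT] at h2
  by_cases hx : x ∈ K <;> by_cases hy : reflectH l ω x ∈ K <;>
    simp only [hx, hy, indicator_of_mem, indicator_of_notMem, not_false_eq_true, hT] <;>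
    by_contra! hn
  · linarith
  · exact hy (h1 hx (by linarith))
  · exact hx (h2 hy (by linarith))
  · linarith

theorem integral_indicator_add_reflectH (hK : IsCompact K) (hKint : (interior K).Nonempty)
    {ω : EuclideanSpace ℝ (Fin N)} (hω : ‖ω‖ = 1) (l : ℝ) :
    ∫ x, (K.indicator (fun x => ⟪x, ω⟫ - l) x +
      K.indicator (fun x => ⟪x, ω⟫ - l) (reflectH l ω x)) =
      2 * (volume.real K * (⟪centerOfMass K, ω⟫ - l)) := by
  have hi := integrable_indicator_inner_sub hK ω l
  have hT : Integrable fun x => K.indicator (fun x => ⟪x, ω⟫ - l) (reflectH l ω x) :=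
    (measurePreserving_reflectH hω l).integrable_comp_of_integrable hi
  rw [integral_add hi hT,
    (measurePreserving_reflectH hω l).integral_comp (measurableEmbedding_reflectH hω l),
    integral_indicator_inner_sub hK hKint]
  ring

theorem inner_centerOfMass_le_of_mem_foldable (hK : IsCompact K) (hKint : (interior K).Nonempty)
    {l : ℝ} {ω : EuclideanSpace ℝ (Fin N)} (hω : ‖ω‖ = 1) (hl : (l, ω) ∈ foldable K) :
    ⟪centerOfMass K, ω⟫ ≤ l := by
  have h0 : 0 < volume.real K :=
    ENNReal.toReal_pos (Measure.measure_pos_of_nonempty_interior _ hKint).ne' hK.measure_lt_top.ne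
  have h := integral_nonpos (μ := volume) (indicator_add_indicator_reflectH_nonpos hω hl)
  rw [integral_indicator_add_reflectH hK hKint hω] at h
  by_contra! hn
  linarith [mul_pos h0 (sub_pos.2 hn)]

theorem reflectH_image_eq_of_mem_foldable (hK : IsCompact K) (hKconv : Convex ℝ K)
    (hKint : (interior K).Nonempty) {ω : EuclideanSpace ℝ (Fin N)} (hω : ‖ω‖ = 1)
    (hl : (⟪centerOfMass K, ω⟫, ω) ∈ foldable K) :
    reflectH ⟪centerOfMass K, ω⟫ ω '' K = K := by
  set l := ⟪centerOfMass K, ω⟫ with hl_def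
  set g : EuclideanSpace ℝ (Fin N) → ℝ := K.indicator (fun x => ⟪x, ω⟫ - l) with hg
  have hi : Integrable g := integrable_indicator_inner_sub hK ω l
  have hgi : Integrable (fun x => -(g x + g (reflectH l ω x))) :=
    (hi.add ((measurePreserving_reflectH hω l).integrable_comp_of_integrable hi)).neg
  have hint : ∫ x, -(g x + g (reflectH l ω x)) = 0 := by
    rw [integral_neg, integral_indicator_add_reflectH hK hKint hω, ← hl_def]
    ring
  have hae := (integral_eq_zero_iff_of_nonneg (fun x => neg_nonneg.2
    (indicator_add_indicator_reflectH_nonpos hω hl x)) hgi).1 hint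
  have hopen : IsOpen (interior K ∩ ((reflectH l ω ⁻¹' Kᶜ) ∩ {x | ⟪x, ω⟫ ≠ l})) :=
    isOpen_interior.inter ((hK.isClosed.isOpen_compl.preimage (continuous_reflectH l ω)).inter
      (isOpen_ne_fun (by fun_prop) (by fun_prop)))
  have hnull : volume (interior K ∩ ((reflectH l ω ⁻¹' Kᶜ) ∩ {x | ⟪x, ω⟫ ≠ l})) = 0 := by
    refine measure_mono_null (fun x hx => ?_) (ae_iff.1 hae)
    obtain ⟨hxK, hxT, hxl⟩ := hx
    have h1 : g x = ⟪x, ω⟫ - l := indicator_of_mem (interior_subset hxK) _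
    have h2 : g (reflectH l ω x) = 0 := indicator_of_notMem hxT _
    change ¬ -(g x + g (reflectH l ω x)) = 0
    rw [h1, h2]
    exact fun h => hxl (by linarith)
  have hempty := (hopen.measure_eq_zero_iff volume).1 hnull
  have hsub : interior K ⊆ reflectH l ω ⁻¹' K := by
    intro x hx
    by_contra hn
    by_cases hxl : ⟪x, ω⟫ = l
    · exact hn (by rw [mem_preimage, reflectH_of_inner_eq hxl]; exact interior_subset hx)
    · exact (eq_empty_iff_forall_notMem.1 hempty) x ⟨hx, hn, hxl⟩
  have hmaps : K ⊆ reflectH l ω ⁻¹' K := by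
    have h := closure_minimal hsub (hK.isClosed.preimage (continuous_reflectH l ω))
    rw [hKconv.closure_interior_eq_closure_of_nonempty_interior hKint] at h
    exact subset_closure.trans h
  exact Subset.antisymm (image_subset_iff.2 hmaps)
    fun x hx => ⟨reflectH l ω x, hmaps hx, reflectH_reflectH hω l x⟩

theorem foldingFn_eq_sInf (K : Set (EuclideanSpace ℝ (Fin N))) (ω : EuclideanSpace ℝ (Fin N)) :
    foldingFn K ω = sInf {l | (l, ω) ∈ foldable K} := rfl

theorem centerOfMass_mem (hK : IsCompact K) (hKconv : Convex ℝ K)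
    (hKint : (interior K).Nonempty) : centerOfMass K ∈ K := by
  have h := hKconv.set_average_mem (μ := volume) (f := id) hK.isClosed
    (Measure.measure_pos_of_nonempty_interior _ hKint).ne' hK.measure_lt_top.ne
    (ae_restrict_mem hK.measurableSet) (ContinuousOn.integrableOn_compact hK continuousOn_id)
  rwa [setAverage_eq] at h

theorem interior_heart_nonempty (hK : IsCompact K) (hKconv : Convex ℝ K)
    (hKint : (interior K).Nonempty)
    (h : ∀ ω : EuclideanSpace ℝ (Fin N), ‖ω‖ = 1 → (⟪centerOfMass K, ω⟫, ω) ∉ foldable K) :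
    (interior (heart K)).Nonempty := by
  set M := centerOfMass K with hM
  set A : Set (ℝ × EuclideanSpace ℝ (Fin N)) := (Icc 0 1 ×ˢ sphere 0 1) ∩
    (fun p : ℝ × EuclideanSpace ℝ (Fin N) => (⟪M, p.2⟫ + p.1, p.2)) ⁻¹' foldable K with hA
  have hAc : IsCompact A := (isCompact_Icc.prod (isCompact_sphere 0 1)).inter_right
    ((isClosed_foldable hK.isClosed).preimage (by fun_prop))
  have hr : ∃ r > 0, r ≤ 1 ∧ ∀ p ∈ A, r ≤ p.1 := by
    rcases A.eq_empty_or_nonempty with h0 | h0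
    · exact ⟨1, one_pos, le_rfl, by simp [h0]⟩
    · obtain ⟨p, hp, hmin⟩ := hAc.exists_isMinOn h0 continuous_fst.continuousOn
      refine ⟨p.1, lt_of_le_of_ne hp.1.1.1 fun h1 => ?_, hp.1.1.2, hmin⟩
      refine h p.2 (mem_sphere_zero_iff_norm.1 hp.1.2) ?_
      simpa [← h1] using hp.2
  obtain ⟨r, hr0, hr1, hr⟩ := hr
  have hR : ∀ ω : EuclideanSpace ℝ (Fin N), ‖ω‖ = 1 → ⟪M, ω⟫ + r ≤ foldingFn K ω := by
    intro ω hω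
    rw [foldingFn_eq_sInf]
    refine le_csInf (exists_mem_foldable hK ω) fun l hl => ?_
    have h1 := inner_centerOfMass_le_of_mem_foldable hK hKint hω hl
    rcases le_total (l - ⟪M, ω⟫) 1 with h2 | h2
    · have h3 := hr (l - ⟪M, ω⟫, ω) ⟨⟨⟨sub_nonneg.2 h1, h2⟩, mem_sphere_zero_iff_norm.2 hω⟩,
        by simpa using hl⟩
      linarith
    · linarith
  have hsub : ball M r ∩ interior K ⊆ heart K := by
    rintro x ⟨hxb, hxK⟩
    refine ⟨interior_subset hxK, fun ω hω => le_trans ?_ (hR ω hω)⟩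
    have h1 := real_inner_le_norm (x - M) ω
    rw [inner_sub_left, hω, mul_one] at h1
    linarith [mem_ball_iff_norm.1 hxb]
  have hMcl : M ∈ closure (interior K) := by
    rw [hKconv.closure_interior_eq_closure_of_nonempty_interior hKint]
    exact subset_closure (centerOfMass_mem hK hKconv hKint)
  exact (mem_closure_iff.1 hMcl _ isOpen_ball (mem_ball_self hr0)).mono
    (interior_maximal hsub (isOpen_ball.inter isOpen_interior))

end Folding

/-- If the heart of a convex body has affine dimension `k` with `1 ≤ k ≤ N - 1`, then
there is a direction `θ` with `R_K(θ) = ⟪M_K, θ⟫` and `K` is `θ`-symmetric. -/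
theorem statement4 {N : ℕ} (K : Set (EuclideanSpace ℝ (Fin N)))
    (hKcpt : IsCompact K) (hKconv : Convex ℝ K) (hKint : (interior K).Nonempty)
    (k : ℕ) (hk₁ : 1 ≤ k) (hk₂ : k ≤ N - 1)
    (hdim : Module.finrank ℝ (affineSpan ℝ (heart K)).direction = k) :
    ∃ θ : EuclideanSpace ℝ (Fin N), ‖θ‖ = 1 ∧
      foldingFn K θ = ⟪centerOfMass K, θ⟫ ∧ ∃ l : ℝ, reflectH l θ '' K = K := by
  by_cases h : ∃ θ : EuclideanSpace ℝ (Fin N), ‖θ‖ = 1 ∧ (⟪centerOfMass K, θ⟫, θ) ∈ foldable K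
  · obtain ⟨θ, hθ, hmem⟩ := h
    have hleast : IsLeast {l | (l, θ) ∈ foldable K} ⟪centerOfMass K, θ⟫ :=
      ⟨hmem, fun l hl => inner_centerOfMass_le_of_mem_foldable hKcpt hKint hθ hl⟩
    exact ⟨θ, hθ, hleast.csInf_eq, _,
      reflectH_image_eq_of_mem_foldable hKcpt hKconv hKint hθ hmem⟩
  · push Not at h
    have htop : affineSpan ℝ (heart K) = ⊤ :=
      affineSpan_eq_top_of_nonempty_interior
        ((interior_heart_nonempty hKcpt hKconv hKint h).mono
          (interior_mono (subset_convexHull ℝ _)))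
    rw [htop, AffineSubspace.direction_top, finrank_top, finrank_euclideanSpace_fin] at hdim
    omega
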